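/- For every integer m ≥ 1, there exists a function h_m ∈ F_m (i.e. h_m: ℝ → [0,1] with h_m(x) = 1 for x ≤ −1, h_m(x) = 0 for x ≥ 1, h_m ∈ C^{m−1}(ℝ) and h_m^{(m−1)} Lipschitz) such that the Lipschitz constant of h_m^{(m−1)} equals 2^{m−2}(m−1)!. -/

import Mathlib

open MeasureTheory Real
open scoped NNReal

/-- The truncated power `(t - x)₊ ^ n`, with the convention that it vanishes for `t ≤ x`. -/
noncomputable def truncPow (n : ℕ) (t x : ℝ) : ℝ := if x < t then (t - x) ^ n else 0

lemma truncPow_succ (n : ℕ) (t x : ℝ) : truncPow (n + 1) t x = (t - x) * truncPow n t x := by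
  unfold truncPow; split_ifs <;> ring

lemma truncPow_one (t x : ℝ) : truncPow 1 t x = max (t - x) 0 := by
  unfold truncPow
  split_ifs with h
  · rw [pow_one, max_eq_left (by linarith)]
  · rw [max_eq_right (by linarith)]

lemma continuous_truncPow_succ (n : ℕ) (t : ℝ) : Continuous (truncPow (n + 1) t) := by
  have : truncPow (n + 1) t = fun x => (max (t - x) 0) ^ (n + 1) := by
    funext x
    unfold truncPow
    split_ifs with h
    · rw [max_eq_left (by linarith)]
    · rw [max_eq_right (by linarith), zero_pow n.succ_ne_zero]
  rw [this]
  fun_prop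

lemma hasDerivAt_truncPow (n : ℕ) (t x : ℝ) :
    HasDerivAt (truncPow (n + 2) t) (-(n + 2) * truncPow (n + 1) t x) x := by
  have off_knot (y : ℝ) (hy : y ≠ t) :
      HasDerivAt (truncPow (n + 2) t) (-(n + 2) * truncPow (n + 1) t y) y := by
    rcases lt_or_gt_of_ne hy with h | h
    · have h₁ : HasDerivAt (fun z : ℝ => (t - z) ^ (n + 2))
          (-(n + 2) * truncPow (n + 1) t y) y := by
        refine (((hasDerivAt_id' y).const_sub t).fun_pow (n + 2)).congr_deriv ?_
        rw [truncPow, if_pos h]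
        push_cast
        ring_nf
      refine h₁.congr_of_eventuallyEq ?_
      filter_upwards [Iio_mem_nhds h] with z hz
      exact if_pos hz
    · have h₁ : HasDerivAt (fun _ : ℝ => (0 : ℝ)) (-(n + 2) * truncPow (n + 1) t y) y := by
        refine (hasDerivAt_const y (0 : ℝ)).congr_deriv ?_
        rw [truncPow, if_neg h.le.not_gt, mul_zero]
      refine h₁.congr_of_eventuallyEq ?_
      filter_upwards [Ioi_mem_nhds h] with z hz
      exact if_neg (not_lt.2 (le_of_lt hz))
  rcases eq_or_ne x t with rfl | hx
  · exact hasDerivAt_of_hasDerivAt_of_ne off_knot (continuous_truncPow_succ _ _).continuousAt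
      (continuous_const.mul (continuous_truncPow_succ n x)).continuousAt
  · exact off_knot x hx

lemma deriv_sum_truncPow {ι : Type*} (s : Finset ι) (w v : ι → ℝ) (n : ℕ) :
    deriv (fun x => ∑ i ∈ s, w i * truncPow (n + 2) (v i) x) =
      fun x => -(n + 2) * ∑ i ∈ s, w i * truncPow (n + 1) (v i) x := by
  funext x
  have h := HasDerivAt.fun_sum (u := s) fun i _ =>
    (hasDerivAt_truncPow n (v i) x).const_mul (w i)
  rw [h.deriv, Finset.mul_sum]
  exact Finset.sum_congr rfl fun i _ => by ring

lemma contDiff_sum_truncPow {ι : Type*} (s : Finset ι) (w v : ι → ℝ) (n : ℕ) :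
    ContDiff ℝ n (fun x => ∑ i ∈ s, w i * truncPow (n + 1) (v i) x) := by
  induction n with
  | zero =>
    exact contDiff_zero.2
      (continuous_finsetSum s fun i _ => (continuous_truncPow_succ 0 (v i)).const_mul (w i))
  | succ n ih =>
    push_cast
    refine contDiff_succ_iff_deriv.2 ⟨fun x => ?_, by simp, ?_⟩
    · exact (HasDerivAt.fun_sum (u := s) fun i _ =>
        (hasDerivAt_truncPow n (v i) x).const_mul (w i)).differentiableAt
    · rw [deriv_sum_truncPow]
      exact contDiff_const.mul ih

lemma iteratedDeriv_sum_truncPow {ι : Type*} (s : Finset ι) (w v : ι → ℝ) (n : ℕ) :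
    iteratedDeriv n (fun x => ∑ i ∈ s, w i * truncPow (n + 1) (v i) x) =
      fun x => (-1) ^ n * ((n + 1).factorial : ℝ) * ∑ i ∈ s, w i * truncPow 1 (v i) x := by
  induction n with
  | zero => simp
  | succ n ih =>
    funext x
    rw [iteratedDeriv_succ', deriv_sum_truncPow, iteratedDeriv_const_mul_field, ih]
    rw [Nat.factorial_succ (n + 1)]
    push_cast
    ring

lemma nodalWeight_mul_sub {ι : Type*} [DecidableEq ι] {s : Finset ι} {v : ι → ℝ}
    (hv : Set.InjOn v s) {a i : ι} (ha : a ∈ s) (hi : i ∈ s.erase a) :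
    Lagrange.nodalWeight s v i * (v i - v a) = Lagrange.nodalWeight (s.erase a) v i := by
  obtain ⟨hia, his⟩ := Finset.mem_erase.1 hi
  have hne : v i - v a ≠ 0 := sub_ne_zero.2 fun h => hia (hv his ha h)
  unfold Lagrange.nodalWeight
  rw [← Finset.mul_prod_erase (s.erase i) _ (Finset.mem_erase.2 ⟨hia.symm, ha⟩),
    Finset.erase_right_comm, mul_right_comm, inv_mul_cancel₀ hne, one_mul]

lemma sum_nodalWeight_mul_sub_mul {ι : Type*} [DecidableEq ι] {s : Finset ι} {v : ι → ℝ}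
    (hv : Set.InjOn v s) {a : ι} (ha : a ∈ s) (f : ι → ℝ) :
    ∑ i ∈ s, Lagrange.nodalWeight s v i * ((v i - v a) * f i) =
      ∑ i ∈ s.erase a, Lagrange.nodalWeight (s.erase a) v i * f i := by
  rw [← Finset.add_sum_erase s _ ha, sub_self, zero_mul, mul_zero, zero_add]
  exact Finset.sum_congr rfl fun i hi => by rw [← mul_assoc, nodalWeight_mul_sub hv ha hi]

/-- The Cox-de Boor recurrence for divided differences. -/
lemma sub_mul_sum_nodalWeight {ι : Type*} [DecidableEq ι] {s : Finset ι} {v : ι → ℝ}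
    (hv : Set.InjOn v s) {a b : ι} (ha : a ∈ s) (hb : b ∈ s) (x : ℝ) (f : ι → ℝ) :
    (v b - v a) * ∑ i ∈ s, Lagrange.nodalWeight s v i * ((v i - x) * f i) =
      (v b - x) * ∑ i ∈ s.erase a, Lagrange.nodalWeight (s.erase a) v i * f i +
      (x - v a) * ∑ i ∈ s.erase b, Lagrange.nodalWeight (s.erase b) v i * f i := by
  rw [← sum_nodalWeight_mul_sub_mul hv ha, ← sum_nodalWeight_mul_sub_mul hv hb,
    Finset.mul_sum, Finset.mul_sum, Finset.mul_sum, ← Finset.sum_add_distrib]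
  exact Finset.sum_congr rfl fun i _ => by ring

lemma sum_nodalWeight_mul_sub_pow {ι : Type*} [DecidableEq ι] {s : Finset ι} {v : ι → ℝ}
    (hv : Set.InjOn v s) {n : ℕ} (hs : s.card = n + 1) (x : ℝ) :
    ∑ i ∈ s, Lagrange.nodalWeight s v i * (v i - x) ^ n = 1 := by
  have hdeg : ((Polynomial.X - Polynomial.C x : Polynomial ℝ) ^ n).degree < s.card := by
    rw [Polynomial.degree_pow, Polynomial.degree_X_sub_C, hs, nsmul_one]
    exact_mod_cast n.lt_succ_self
  have h := Lagrange.coeff_eq_sum hv hdeg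
  have hc : ((Polynomial.X - Polynomial.C x : Polynomial ℝ) ^ n).coeff n = 1 := by
    have := ((Polynomial.monic_X_sub_C x).pow n).coeff_natDegree
    rwa [Polynomial.natDegree_pow, Polynomial.natDegree_X_sub_C, mul_one] at this
  rw [hs, Nat.add_sub_cancel, hc] at h
  rw [h]
  refine Finset.sum_congr rfl fun i _ => ?_
  rw [Lagrange.nodalWeight, Finset.prod_inv_distrib]
  simp
  ring

lemma sum_nodalWeight_mul_truncPow_eq_zero {ι : Type*} [DecidableEq ι] {s : Finset ι} {v : ι → ℝ}
    (n : ℕ) {x : ℝ} (hx : ∀ i ∈ s, v i ≤ x) :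
    ∑ i ∈ s, Lagrange.nodalWeight s v i * truncPow n (v i) x = 0 :=
  Finset.sum_eq_zero fun i hi => by rw [truncPow, if_neg (not_lt.2 (hx i hi)), mul_zero]

lemma sum_nodalWeight_mul_truncPow_eq_one {ι : Type*} [DecidableEq ι] {s : Finset ι} {v : ι → ℝ}
    (hv : Set.InjOn v s) {n : ℕ} (hs : s.card = n + 1) {x : ℝ} (hx : ∀ i ∈ s, x < v i) :
    ∑ i ∈ s, Lagrange.nodalWeight s v i * truncPow n (v i) x = 1 := by
  rw [← sum_nodalWeight_mul_sub_pow hv hs x]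
  exact Finset.sum_congr rfl fun i hi => by rw [truncPow, if_pos (hx i hi)]

lemma sum_nodalWeight_mul_truncPow_mem_Icc {ι : Type*} [DecidableEq ι] {v : ι → ℝ} {n : ℕ}
    {s : Finset ι} (hv : Set.InjOn v s) (hs : s.card = n + 1) (x : ℝ) :
    ∑ i ∈ s, Lagrange.nodalWeight s v i * truncPow n (v i) x ∈ Set.Icc (0 : ℝ) 1 := by
  induction n generalizing s with
  | zero =>
    obtain ⟨a, rfl⟩ := Finset.card_eq_one.1 hs
    simp only [Finset.sum_singleton, Lagrange.nodalWeight, truncPow]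
    split_ifs <;> simp
  | succ n ih =>
    have hne : s.Nonempty := Finset.card_pos.1 (by omega)
    obtain ⟨a, ha, hmin⟩ := Finset.exists_min_image s v hne
    obtain ⟨b, hb, hmax⟩ := Finset.exists_max_image s v hne
    rcases lt_or_ge x (v a) with hxa | hxa
    · rw [sum_nodalWeight_mul_truncPow_eq_one hv hs fun i hi => hxa.trans_le (hmin i hi)]
      simp
    rcases le_or_gt (v b) x with hxb | hxb
    · rw [sum_nodalWeight_mul_truncPow_eq_zero _ fun i hi => (hmax i hi).trans hxb]
      simp
    have hrec := sub_mul_sum_nodalWeight hv ha hb x fun i => truncPow n (v i) x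
    simp only [← truncPow_succ] at hrec
    obtain ⟨hA₀, hA₁⟩ := ih (hv.mono (Finset.erase_subset a s))
      (by rw [Finset.card_erase_of_mem ha, hs, Nat.add_sub_cancel])
    obtain ⟨hB₀, hB₁⟩ := ih (hv.mono (Finset.erase_subset b s))
      (by rw [Finset.card_erase_of_mem hb, hs, Nat.add_sub_cancel])
    have hab : 0 < v b - v a := by linarith
    constructor
    · refine nonneg_of_mul_nonneg_right ?_ hab
      rw [hrec]
      exact add_nonneg (mul_nonneg (by linarith) hA₀) (mul_nonneg (by linarith) hB₀)
    · refine le_of_mul_le_mul_left ?_ hab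
      rw [hrec]
      nlinarith [mul_le_mul_of_nonneg_left hA₁ (sub_nonneg.2 hxb.le),
        mul_le_mul_of_nonneg_left hB₁ (sub_nonneg.2 hxa)]

open Polynomial Polynomial.Chebyshev in
lemma nodal_node {m : ℕ} (hm : 1 ≤ m) :
    (C ((m : ℝ) * 2 ^ (m - 1)) * Lagrange.nodal (Finset.range (m + 1)) (node m) : ℝ[X]) =
      (X ^ 2 - 1) * derivative (T ℝ m) := by
  obtain ⟨n, rfl⟩ := Nat.exists_eq_add_of_le' hm
  have hT : derivative (T ℝ ((n + 1 : ℕ) : ℤ)) = C ((n : ℝ) + 1) * U ℝ n := by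
    rw [T_derivative_eq_U]
    simp
  have hU : (U ℝ n).leadingCoeff = 2 ^ n := by simp
  have hUd : (U ℝ n).degree = n := by simp
  have hn : (n : ℝ) + 1 ≠ 0 := by positivity
  have hX : (X ^ 2 - 1 : ℝ[X]).degree = 2 := by
    simpa using degree_X_pow_sub_C (R := ℝ) (n := 2) (by norm_num) 1
  have hXl : (X ^ 2 - 1 : ℝ[X]).leadingCoeff = 1 := by
    simpa only [map_one] using leadingCoeff_X_pow_sub_C (R := ℝ) (n := 2) (by norm_num) (r := 1)
  have hR : ((X ^ 2 - 1 : ℝ[X]) * (C ((n : ℝ) + 1) * U ℝ n)).degree = (n + 2 : ℕ) := by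
    rw [degree_mul, degree_mul, degree_C hn, hX, hUd]
    push_cast
    ring
  have hc : ((n + 1 : ℕ) : ℝ) * 2 ^ (n + 1 - 1) ≠ 0 := by positivity
  rw [hT]
  refine eq_of_degree_sub_lt_of_eval_index_eq (Finset.range (n + 1 + 1))
    (strictAntiOn_node (n + 1)).injOn ?_ fun i hi => ?_
  · rw [Finset.card_range]
    have hL : (C (((n + 1 : ℕ) : ℝ) * 2 ^ (n + 1 - 1)) *
        Lagrange.nodal (Finset.range (n + 1 + 1)) (node (n + 1)) : ℝ[X]).degree = (n + 2 : ℕ) := by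
      rw [degree_mul, degree_C hc, Lagrange.degree_nodal, Finset.card_range, zero_add]
    refine (degree_sub_lt_left (hL.trans hR.symm) ?_ ?_).trans_eq hL
    · exact mul_ne_zero (C_ne_zero.2 hc) Lagrange.nodal_ne_zero
    · rw [leadingCoeff_mul, leadingCoeff_mul, leadingCoeff_mul, leadingCoeff_C, leadingCoeff_C,
        hXl, hU, Lagrange.nodal_monic.leadingCoeff]
      simp
  · rw [eval_mul, Lagrange.eval_nodal_at_node hi, mul_zero, ← hT]
    have h := congrArg (eval (node (n + 1) i))
      (one_sub_X_sq_mul_derivative_T_eq_poly_in_T (R := ℝ) n)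
    have hTn : eval (node (n + 1) i) (T ℝ (n : ℤ) - X * T ℝ ((n : ℤ) + 1)) = 0 := by
      have hθ : ((n : ℝ) + 1) * (i * π / (n + 1)) = i * π := by field_simp
      have hs : sin (((n : ℝ) + 1) * (i * π / (n + 1))) = 0 := by rw [hθ, sin_nat_mul_pi]
      have hnθ : (n : ℝ) * (i * π / (n + 1)) =
          ((n : ℝ) + 1) * (i * π / (n + 1)) - i * π / (n + 1) := by ring
      rw [eval_sub, eval_mul, eval_X, node]
      push_cast
      rw [T_real_cos, T_real_cos]
      push_cast
      rw [hnθ, cos_sub, hs]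
      ring
    rw [eval_mul, eval_mul, hTn, mul_zero] at h
    rw [eval_mul]
    push_cast
    simp only [eval_sub, eval_one, eval_pow, eval_X] at h ⊢
    linear_combination h

open Polynomial Polynomial.Chebyshev in
lemma nodalWeight_node {m : ℕ} (hm : 1 ≤ m) {k : ℕ} (hk : k ∈ Finset.range (m + 1)) :
    Lagrange.nodalWeight (Finset.range (m + 1)) (node m) k =
      (2 : ℝ) ^ ((m : ℤ) - 2) / m * ((-1) ^ k * (2 - (if k = 0 then 1 else 0) -
        (if k = m then 1 else 0))) := by
  have hkm : k ≤ m := Finset.mem_range_succ_iff.1 hk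
  have hm0 : (m : ℝ) ≠ 0 := by positivity
  have hpow : (2 : ℝ) ^ (m - 1) = 2 * 2 ^ ((m : ℤ) - 2) := by
    rw [← zpow_natCast, ← zpow_one_add₀ (by norm_num)]
    congr 1
    omega
  have hT : eval (node m k) (T ℝ m) = (-1) ^ k := eval_T_real_node (Finset.mem_Iic.2 hkm)
  have hd := congrArg (fun p => eval (node m k) (derivative p)) (nodal_node hm)
  have hode := congrArg (eval (node m k))
    (one_sub_X_sq_mul_derivative_derivative_T_eq_poly_in_T (R := ℝ) m)
  have hv := congrArg (eval (node m k)) (nodal_node hm)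
  rw [eval_mul, Lagrange.eval_nodal_at_node hk, mul_zero, eval_mul] at hv
  simp only [eval_mul, eval_C, derivative_mul, derivative_sub, derivative_X_pow,
    derivative_one, eval_add, eval_sub, eval_pow, eval_X, eval_one, eval_zero,
    Function.iterate_succ, Function.iterate_zero, Function.comp_apply, id_eq,
    Int.cast_natCast, hT, hpow] at hd hode hv
  norm_num at hd hode
  rw [Lagrange.nodalWeight_eq_eval_derivative_nodal hk]
  have hsum : (m : ℝ) * (2 * 2 ^ ((m : ℤ) - 2)) *
      eval (node m k) (derivative (Lagrange.nodal (Finset.range (m + 1)) (node m))) =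
      node m k * eval (node m k) (derivative (T ℝ m)) + m ^ 2 * (-1) ^ k := by
    linear_combination hd - hode
  have hcase : node m k * eval (node m k) (derivative (T ℝ m)) =
      m ^ 2 * (-1) ^ k * ((if k = 0 then 1 else 0) + (if k = m then 1 else 0)) := by
    have hm0' : 0 ≠ m := by omega
    rcases eq_or_ne k 0 with rfl | hk0
    · rw [node_eq_one] at hode ⊢
      simp only [if_true, if_neg hm0']
      linarith
    rcases eq_or_ne k m with rfl | hkm'
    · rw [node_eq_neg_one hk0] at hode ⊢
      simp only [if_true, if_neg hk0]
      linarith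
    have h₁ : node m k < 1 := (node_lt hkm (Nat.pos_of_ne_zero hk0)).trans_eq node_eq_one
    have h₂ : -1 < node m k := (node_eq_neg_one hm0'.symm).symm.trans_lt
      (node_lt le_rfl (lt_of_le_of_ne hkm hkm'))
    have h₃ : node m k ^ 2 - 1 ≠ 0 := by nlinarith
    rw [(mul_eq_zero.1 hv.symm).resolve_left h₃]
    simp [hk0, hkm']
  rw [hcase] at hsum
  have hε : (-1 : ℝ) ^ k * (-1) ^ k = 1 := by rw [← mul_pow]; simp
  have hidem : ((if k = 0 then 1 else 0) + (if k = m then 1 else 0) : ℝ) ^ 2 =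
      (if k = 0 then 1 else 0) + (if k = m then 1 else 0) := by
    split_ifs <;> first | omega | norm_num
  rw [sub_sub]
  generalize ((if k = 0 then 1 else 0) + (if k = m then 1 else 0) : ℝ) = a at hsum hidem ⊢
  generalize eval (node m k) (derivative (Lagrange.nodal (Finset.range (m + 1)) (node m))) = D
    at hsum ⊢
  have hD : 2 * 2 ^ ((m : ℤ) - 2) * D = m * (-1) ^ k * (1 + a) :=
    mul_left_cancel₀ hm0 (by linear_combination hsum)
  refine inv_eq_of_mul_eq_one_right ?_
  rw [div_mul_eq_mul_div, mul_div_assoc', div_eq_one_iff_eq hm0]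
  linear_combination ((-1) ^ k * (2 - a) / 2) * hD + (m * (1 + a) * (2 - a) / 2) * hε -
    (m / 2) * hidem

lemma sum_range_alternating_sub {m : ℕ} (p : ℕ → ℝ) :
    ∑ k ∈ Finset.range m, (-1) ^ k * (p k - p (k + 1)) =
      ∑ k ∈ Finset.range (m + 1), (-1) ^ k * (2 - (if k = 0 then 1 else 0) -
        (if k = m then 1 else 0)) * p k := by
  have h₁ := Finset.sum_range_succ (fun k => (-1 : ℝ) ^ k * p k) m
  have h₂ := Finset.sum_range_succ' (fun k => (-1 : ℝ) ^ k * p k) m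
  simp only [mul_sub, sub_mul, Finset.sum_sub_distrib, mul_ite, ite_mul, mul_one, mul_zero,
    zero_mul, Finset.sum_ite_eq', Finset.mem_range]
  simp only [pow_succ, mul_neg_one, neg_mul, Finset.sum_neg_distrib] at h₂
  simp only [mul_right_comm _ (2 : ℝ), ← Finset.sum_mul]
  simp at h₁ h₂ ⊢
  linarith

lemma antitone_max_sub_max {a b : ℝ} (hab : b ≤ a) :
    Antitone fun x => max (a - x) 0 - max (b - x) 0 := by
  intro x y hxy
  grind

lemma lipschitzWith_alternating_sum {m : ℕ} {t : ℕ → ℝ} (ht : ∀ k < m, t (k + 1) ≤ t k) :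
    LipschitzWith 1 fun x => ∑ k ∈ Finset.range m,
      (-1) ^ k * (max (t k - x) 0 - max (t (k + 1) - x) 0) := by
  have key (x y : ℝ) (hxy : x ≤ y) :
      |∑ k ∈ Finset.range m, (-1) ^ k * (max (t k - x) 0 - max (t (k + 1) - x) 0) -
        ∑ k ∈ Finset.range m, (-1) ^ k * (max (t k - y) 0 - max (t (k + 1) - y) 0)| ≤ y - x := by
    rw [← Finset.sum_sub_distrib]
    calc _ ≤ ∑ k ∈ Finset.range m, ((max (t k - x) 0 - max (t (k + 1) - x) 0) -
          (max (t k - y) 0 - max (t (k + 1) - y) 0)) := by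
          refine (Finset.abs_sum_le_sum_abs _ _).trans (Finset.sum_le_sum fun k hk => ?_)
          rw [← mul_sub, abs_mul, abs_neg_one_pow, one_mul, abs_of_nonneg]
          exact sub_nonneg.2 (antitone_max_sub_max (ht k (Finset.mem_range.1 hk)) hxy)
      _ = (max (t 0 - x) 0 - max (t m - x) 0) - (max (t 0 - y) 0 - max (t m - y) 0) := by
          rw [Finset.sum_sub_distrib, Finset.sum_range_sub' fun k => max (t k - x) 0,
            Finset.sum_range_sub' fun k => max (t k - y) 0]
      _ ≤ y - x := by grind
  refine LipschitzWith.of_dist_le_mul fun x y => ?_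
  rw [NNReal.coe_one, one_mul]
  rcases le_total x y with h | h
  · rw [dist_comm x y, Real.dist_eq, Real.dist_eq, abs_of_nonneg (sub_nonneg.2 h)]
    exact key x y h
  · rw [dist_comm, Real.dist_eq, Real.dist_eq, abs_of_nonneg (sub_nonneg.2 h)]
    exact key y x h

lemma alternating_sum_max_sub {m : ℕ} (hm : 1 ≤ m) {t : ℕ → ℝ}
    (ht : ∀ k, 1 ≤ k → k ≤ m → t k ≤ t 1) {x : ℝ} (hx : t 1 ≤ x) :
    ∑ k ∈ Finset.range m, (-1) ^ k * (max (t k - x) 0 - max (t (k + 1) - x) 0) =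
      max (t 0 - x) 0 := by
  rw [Finset.sum_eq_single_of_mem 0 (Finset.mem_range.2 hm)]
  · rw [zero_add, max_eq_right (sub_nonpos.2 hx), pow_zero, one_mul, sub_zero]
  · intro k hk hk0
    have hkm := Finset.mem_range.1 hk
    rw [max_eq_right (sub_nonpos.2 ((ht k (by omega) (by omega)).trans hx)),
      max_eq_right (sub_nonpos.2 ((ht (k + 1) (by omega) (by omega)).trans hx)), sub_zero, mul_zero]

open Polynomial.Chebyshev in
lemma sum_nodalWeight_node_mul {m : ℕ} (hm : 1 ≤ m) (p : ℕ → ℝ) :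
    ∑ k ∈ Finset.range (m + 1), Lagrange.nodalWeight (Finset.range (m + 1)) (node m) k * p k =
      (2 : ℝ) ^ ((m : ℤ) - 2) / m * ∑ k ∈ Finset.range m, (-1) ^ k * (p k - p (k + 1)) := by
  rw [sum_range_alternating_sub, Finset.mul_sum]
  exact Finset.sum_congr rfl fun k hk => by rw [nodalWeight_node hm hk, mul_assoc]

open Polynomial.Chebyshev in
/-- For every `m ≥ 1` there exists `h ∈ F_m` whose `(m-1)`-th derivative has (best) Lipschitz
constant exactly `2^(m-2) (m-1)!`. -/
theorem exists_indicator_approximation_with_optimal_lipschitz_constant (m : ℕ) (hm : 1 ≤ m) :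
    ∃ h : ℝ → ℝ,
      (∀ x ≤ (-1 : ℝ), h x = 1) ∧
      (∀ x : ℝ, (1 : ℝ) ≤ x → h x = 0) ∧
      (∀ x, h x ∈ Set.Icc (0 : ℝ) 1) ∧
      ContDiff ℝ (↑(m - 1)) h ∧
      LipschitzWith (Real.toNNReal ((2 : ℝ) ^ ((m : ℤ) - 2) * (Nat.factorial (m - 1) : ℝ)))
        (iteratedDeriv (m - 1) h) ∧
      (∀ L : ℝ≥0, LipschitzWith L (iteratedDeriv (m - 1) h) →
        (2 : ℝ) ^ ((m : ℤ) - 2) * (Nat.factorial (m - 1) : ℝ) ≤ (L : ℝ)) := by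
  have hinj := (strictAntiOn_node m).injOn
  have hcard := Finset.card_range (m + 1)
  set K := (2 : ℝ) ^ ((m : ℤ) - 2) * (Nat.factorial (m - 1) : ℝ) with hK
  have hKpos : 0 < K := by positivity
  have hm1 : m - 1 + 1 = m := Nat.sub_add_cancel hm
  let h : ℝ → ℝ := fun x => ∑ k ∈ Finset.range (m + 1),
    Lagrange.nodalWeight (Finset.range (m + 1)) (node m) k * truncPow m (node m k) x
  let f : ℝ → ℝ := fun x => ∑ k ∈ Finset.range m,
    (-1) ^ k * (max (node m k - x) 0 - max (node m (k + 1) - x) 0)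
  have hcont : ContDiff ℝ (↑(m - 1)) h := by
    have := contDiff_sum_truncPow (Finset.range (m + 1))
      (Lagrange.nodalWeight (Finset.range (m + 1)) (node m)) (node m) (m - 1)
    rwa [hm1] at this
  have hderiv : iteratedDeriv (m - 1) h = fun x => (-1) ^ (m - 1) * K * f x := by
    have := iteratedDeriv_sum_truncPow (Finset.range (m + 1))
      (Lagrange.nodalWeight (Finset.range (m + 1)) (node m)) (node m) (m - 1)
    rw [hm1] at this
    refine this.trans (funext fun x => ?_)
    have hm0 : (m : ℝ) ≠ 0 := by positivity
    rw [sum_nodalWeight_node_mul hm, ← Nat.mul_factorial_pred (by omega), hK]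
    simp only [truncPow_one, f]
    push_cast
    field_simp
  have hdist (x y : ℝ) : dist (iteratedDeriv (m - 1) h x) (iteratedDeriv (m - 1) h y) =
      K * dist (f x) (f y) := by
    rw [hderiv, Real.dist_eq, Real.dist_eq, ← mul_sub, abs_mul, abs_mul, abs_neg_one_pow, one_mul,
      abs_of_pos hKpos]
  refine ⟨h, fun x hx => ?_, fun x hx => ?_,
    sum_nodalWeight_mul_truncPow_mem_Icc hinj hcard, hcont, ?_, fun L hL => ?_⟩
  · have hlt (y : ℝ) (hy : y < -1) : h y = 1 :=
      sum_nodalWeight_mul_truncPow_eq_one hinj hcard fun i _ => hy.trans_le node_mem_Icc.1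
    exact closure_minimal (s := Set.Iio (-1)) hlt
      (isClosed_eq hcont.continuous continuous_const) (by rwa [closure_Iio])
  · exact sum_nodalWeight_mul_truncPow_eq_zero m fun i _ => node_mem_Icc.2.trans hx
  · refine LipschitzWith.of_dist_le_mul fun x y => ?_
    rw [hdist, Real.coe_toNNReal _ hKpos.le]
    have := (lipschitzWith_alternating_sum (m := m) (t := node m)
      fun k hk => (node_lt hk k.lt_succ_self).le).dist_le_mul x y
    rw [NNReal.coe_one, one_mul] at this
    exact mul_le_mul_of_nonneg_left this hKpos.le
  · have h01 : node m 1 < node m 0 := node_lt hm one_pos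
    have hle (k : ℕ) (hk : 1 ≤ k) (hkm : k ≤ m) : node m k ≤ node m 1 :=
      (strictAntiOn_node m).antitoneOn (Finset.mem_coe.2 (Finset.mem_range.2 (by omega)))
        (Finset.mem_coe.2 (Finset.mem_range.2 (by omega))) hk
    have hL' := hL.dist_le_mul (node m 1) (node m 0)
    have hf (x : ℝ) (hx : node m 1 ≤ x) : f x = max (node m 0 - x) 0 :=
      alternating_sum_max_sub hm hle hx
    rw [hdist, hf _ le_rfl, hf _ h01.le, sub_self, max_self, max_eq_left (sub_nonneg.2 h01.le),
      Real.dist_eq, sub_zero, dist_comm, Real.dist_eq] at hL'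
    exact le_of_mul_le_mul_right hL' (abs_pos.2 (sub_ne_zero.2 h01.ne'))
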